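/- Let A = A_1 ⊕ ... ⊕ A_m be a finite direct sum of simple C-algebras A_i. Then the ideals of A are exactly the subspaces ⊕_{i ∈ S} A_i for subsets S ⊆ [1,m]. -/

import Mathlib

/-- Data of a linear operad: spaces of `n`-ary operations, an identity operation,
and partial compositions. -/
structure LinearOperadData (F : Type) [Field F] where
  C : ℕ → Type
  one : C 1
  comp : ∀ {m n : ℕ}, C m → C n → Fin m → C (m + n - 1)

/-- An algebra over (the data of) a linear operad: structure maps
`α n : C n → MultilinearMap`, compatible with identity and composition. -/
structure OperadAlgebraOn (F : Type) [Field F] (O : LinearOperadData F)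
    (A : Type) [AddCommGroup A] [Module F A] where
  α : ∀ n, O.C n → MultilinearMap F (fun _ : Fin n => A) A
  α_one : ∀ a : A, α 1 O.one (fun _ => a) = a
  α_comp : ∀ {m n : ℕ} (c : O.C m) (d : O.C n) (i : Fin m) (v : Fin (m + n - 1) → A),
    α (m + n - 1) (O.comp c d i) v =
      α m c (fun k =>
        if hk : (k : ℕ) < (i : ℕ) then v ⟨k, by have := k.isLt; have := i.isLt; omega⟩
        else if hk2 : (k : ℕ) = (i : ℕ) then
          α n d (fun j => v ⟨(i : ℕ) + (j : ℕ), by have := j.isLt; have := i.isLt; omega⟩)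
        else v ⟨(k : ℕ) + n - 1, by have := k.isLt; have := i.isLt; omega⟩)

variable {F : Type} [Field F] {O : LinearOperadData F}
variable {A : Type} [AddCommGroup A] [Module F A]

/-- The partial multiplication operator `a ↦ α n c (v_1,...,a at slot j,...,v_{n-1})`. -/
def OperadAlgebraOn.op (OA : OperadAlgebraOn F O A) {n : ℕ} (c : O.C n)
    (v : Fin n → A) (j : Fin n) : Module.End F A :=
  (OA.α n c).toLinearMap v j

/-- `E_A`: the span of the partial multiplication operators with `n ≥ 2` inputs. -/
def EA (OA : OperadAlgebraOn F O A) : Submodule F (Module.End F A) :=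
  Submodule.span F
    {T | ∃ n : ℕ, 2 ≤ n ∧ ∃ (c : O.C n) (v : Fin n → A) (j : Fin n), T = OA.op c v j}

/-- `L_A`: the image of `C(1)` in `End_F(A)`. -/
def LA (OA : OperadAlgebraOn F O A) : Submodule F (Module.End F A) :=
  Submodule.span F {T | ∃ c : O.C 1, T = OA.op c (fun _ => (0 : A)) 0}

/-- `R_A = L_A + E_A`. -/
def RA (OA : OperadAlgebraOn F O A) : Submodule F (Module.End F A) :=
  LA OA ⊔ EA OA

/-- A subspace `I ⊆ A` is an ideal: closed under all operadic operations whenever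
at least one argument lies in `I`. -/
def IsIdealPred (OA : OperadAlgebraOn F O A) (I : Submodule F A) : Prop :=
  ∀ (n : ℕ) (c : O.C n) (v : Fin n → A) (j : Fin n), v j ∈ I → OA.α n c v ∈ I

/-- A relative ideal `J` of the subalgebra `P ⊆ A`. -/
def IsIdealIn (OA : OperadAlgebraOn F O A) (P J : Submodule F A) : Prop :=
  J ≤ P ∧ ∀ (n : ℕ) (c : O.C n) (v : Fin n → A) (j : Fin n),
    (∀ k, v k ∈ P) → v j ∈ J → OA.α n c v ∈ J

/-- The multiplications (with `n ≥ 2`) of `A` do not all vanish on the subspace `P`. -/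
def HasNonzeroMul (OA : OperadAlgebraOn F O A) (P : Submodule F A) : Prop :=
  ∃ n : ℕ, 2 ≤ n ∧ ∃ (c : O.C n) (v : Fin n → A), (∀ k, v k ∈ P) ∧ OA.α n c v ≠ 0

/-- `P` is a simple summand: an ideal of `A`, with no nontrivial subideals,
on which the multiplication is nonzero. -/
def IsSimplePiece (OA : OperadAlgebraOn F O A) (P : Submodule F A) : Prop :=
  IsIdealPred OA P ∧ (∀ J ≤ P, IsIdealPred OA J → J = ⊥ ∨ J = P) ∧ HasNonzeroMul OA P

/-- `A` is a simple `C`-algebra: the only ideals are `0` and `A`, and `E_A ≠ 0`. -/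
def IsSimpleAlg (OA : OperadAlgebraOn F O A) : Prop :=
  (∀ I : Submodule F A, IsIdealPred OA I → I = ⊥ ∨ I = ⊤) ∧ EA OA ≠ ⊥

/-- `A` is a semisimple `C`-algebra: a finite direct sum of simple `C`-algebras. -/
def IsSemisimpleAlg (OA : OperadAlgebraOn F O A) : Prop :=
  ∃ (m : ℕ) (P : Fin m → Submodule F A),
    iSupIndep P ∧ (⨆ i, P i) = ⊤ ∧ ∀ i, IsSimplePiece OA (P i)

/-- The group of `C`-algebra automorphisms of `A`, as a subgroup of `A ≃ₗ[F] A`. -/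
def AlgAutGroup (OA : OperadAlgebraOn F O A) : Subgroup (A ≃ₗ[F] A) where
  carrier := {f | ∀ (n : ℕ) (c : O.C n) (v : Fin n → A),
    f (OA.α n c v) = OA.α n c (fun k => f (v k))}
  one_mem' := by intro n c v; rfl
  mul_mem' := by
    intro f g hf hg n c v
    show f (g (OA.α n c v)) = _
    rw [hg, hf]
    rfl
  inv_mem' := by
    intro f hf n c v
    have h1 : ∀ x : A, f (f⁻¹ x) = x := fun x => f.apply_symm_apply x
    apply f.injective
    rw [h1, hf]
    simp only [h1]

/-- A maximal (proper) ideal of `A`. -/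
def IsMaxIdeal (OA : OperadAlgebraOn F O A) (M : Submodule F A) : Prop :=
  IsIdealPred OA M ∧ M ≠ ⊤ ∧ ∀ J, IsIdealPred OA J → M < J → J = ⊤

/-- The kernel of the projection to the maximal semisimple quotient of `A`
as an `R_A`-module (the intersection of the maximal ideals). -/
def preRad (OA : OperadAlgebraOn F O A) : Submodule F A :=
  sInf {M | IsMaxIdeal OA M}

/-- The radical of the `C`-algebra `A`: the kernel of `A → Ā`, where `Ā` is the quotient of
the maximal semisimple `R_A`-module quotient `A' = A / preRad` by the kernel of the
`E_A`-action. -/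
def radAlg (OA : OperadAlgebraOn F O A) : Submodule F A :=
  ⨅ (e : Module.End F A) (_ : e ∈ EA OA), (preRad OA).comap e

/-- An operad algebra structure on `A ⧸ I` compatible with the projection. -/
def IsQuotientAlg (OA : OperadAlgebraOn F O A) (I : Submodule F A)
    (OQ : OperadAlgebraOn F O (A ⧸ I)) : Prop :=
  ∀ (n : ℕ) (c : O.C n) (v : Fin n → A),
    I.mkQ (OA.α n c v) = OQ.α n c (fun k => I.mkQ (v k))

/-- A componentwise ("pointwise") operad algebra structure on a product. -/
def IsComponentwiseAlg {ι : Type} {B : ι → Type} [∀ i, AddCommGroup (B i)]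
    [∀ i, Module F (B i)] (OB : ∀ i, OperadAlgebraOn F O (B i))
    (OP : OperadAlgebraOn F O (∀ i, B i)) : Prop :=
  ∀ (n : ℕ) (c : O.C n) (v : Fin n → ∀ i, B i) (i : ι),
    OP.α n c v i = (OB i).α n c (fun k => v k i)

/-- Pointwise algebra structure on `ι → B`. -/
def IsPointwiseAlg {ι B : Type} [AddCommGroup B] [Module F B]
    (OB : OperadAlgebraOn F O B) (OP : OperadAlgebraOn F O (ι → B)) : Prop :=
  ∀ (n : ℕ) (c : O.C n) (v : Fin n → ι → B) (i : ι),
    OP.α n c v i = OB.α n c (fun k => v k i)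

/-- Block-diagonal inclusion `End(B i) → End(Π j, B j)`. -/
def blkMap {ι : Type} [DecidableEq ι] (B : ι → Type) [∀ i, AddCommGroup (B i)]
    [∀ i, Module F (B i)] (i : ι) :
    Module.End F (B i) →ₗ[F] Module.End F (∀ j, B j) where
  toFun T := (LinearMap.single F B i) ∘ₗ T ∘ₗ (LinearMap.proj i)
  map_add' := by
    intro T S
    ext v j
    simp [Pi.single_add]
  map_smul' := by
    intro t T
    ext v j
    simp [Pi.single_smul]

/-- The action of `Perm ι` on `ι → K` by permuting coordinates. -/
def permAct (ι K : Type) [Group K] : Equiv.Perm ι →* MulAut (ι → K) where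
  toFun σ :=
    { toFun := fun f => f ∘ σ.symm
      invFun := fun f => f ∘ σ
      left_inv := fun f => by funext x; simp
      right_inv := fun f => by funext x; simp
      map_mul' := fun f g => rfl }
  map_one' := by
    ext f x
    rfl
  map_mul' := by
    intro σ τ
    ext f x
    rfl

/-- Right translation action of `G` on `G → B`. -/
def rightTrans (G B : Type) [Group G] (g : G) : (G → B) → (G → B) :=
  fun f x => f (x * g)

/-- The space `Fun_H(G, B)` of `H`-equivariant functions `G → B`. -/
def FunHsub (G : Type) [Group G] (B : Type) [AddCommGroup B] [Module F B]
    (H : Subgroup G) (OB : OperadAlgebraOn F O B) (φ : H →* AlgAutGroup OB) :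
    Submodule F (G → B) where
  carrier := {f | ∀ (h : H) (x : G),
    f ((h : G) * x) = ((φ h : AlgAutGroup OB) : B ≃ₗ[F] B) (f x)}
  add_mem' := by
    intro f g hf hg h x
    simp [hf h x, hg h x]
  zero_mem' := by intro h x; simp
  smul_mem' := by
    intro t f hf h x
    simp [hf h x]

/-- A bundled `C`-algebra (used for existential quantification over algebras). -/
structure OperadAlgBundle (F : Type) [Field F] (O : LinearOperadData F) where
  carrier : Type
  [acg : AddCommGroup carrier]
  [mod : Module F carrier]
  alg : OperadAlgebraOn F O carrier

attribute [instance] OperadAlgBundle.acg OperadAlgBundle.mod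

/-- `(A, ρ)` is modeled by `Fun_H(G, B)` for the pair `(H, φ)`:
there is an injective `G`-equivariant `C`-algebra map of `A` onto the subalgebra
`Fun_H(G, B)` of the pointwise algebra `G → B`, where `B` is simple and `G` acts by
right translation. -/
def IsFunHModel {G : Type} [Group G] (OA : OperadAlgebraOn F O A)
    (ρ : G →* (A ≃ₗ[F] A)) (H : Subgroup G) (Bb : OperadAlgBundle F O)
    (φ : H →* AlgAutGroup Bb.alg) : Prop :=
  IsSimpleAlg Bb.alg ∧
  ∃ OGB : OperadAlgebraOn F O (G → Bb.carrier),
    IsPointwiseAlg Bb.alg OGB ∧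
    ∃ e : A →ₗ[F] (G → Bb.carrier), Function.Injective e ∧
      LinearMap.range e = FunHsub G Bb.carrier H Bb.alg φ ∧
      (∀ (n : ℕ) (c : O.C n) (v : Fin n → A),
        e (OA.α n c v) = OGB.α n c fun k => e (v k)) ∧
      (∀ (g : G) (a : A) (x : G), e (ρ g a) x = e a (x * g))

namespace OperadAlgebraOn

variable {OA : OperadAlgebraOn F O A}

theorem op_apply {n : ℕ} (c : O.C n) (v : Fin n → A) (j : Fin n) (a : A) :
    OA.op c v j a = OA.α n c (Function.update v j a) := rfl

theorem isIdealPred_iff_le_comap {I : Submodule F A} :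
    IsIdealPred OA I ↔
      ∀ (n : ℕ) (c : O.C n) (v : Fin n → A) (j : Fin n), I ≤ I.comap (OA.op c v j) := by
  refine ⟨fun h n c v j a ha => ?_, fun h n c v j hv => ?_⟩
  · exact h n c _ j (by simpa using ha)
  · have := h n c v j hv
    rwa [Submodule.mem_comap, op_apply, Function.update_eq_self] at this

theorem isIdealPred_iSup {ι : Sort*} {I : ι → Submodule F A}
    (h : ∀ i, IsIdealPred OA (I i)) : IsIdealPred OA (⨆ i, I i) :=
  isIdealPred_iff_le_comap.2 fun n c v j => iSup_le fun i =>
    (isIdealPred_iff_le_comap.1 (h i) n c v j).trans (Submodule.comap_mono (le_iSup I i))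

theorem isIdealPred_sup {I J : Submodule F A} (hI : IsIdealPred OA I) (hJ : IsIdealPred OA J) :
    IsIdealPred OA (I ⊔ J) := by
  rw [sup_eq_iSup]
  exact isIdealPred_iSup (by rintro (_ | _) <;> assumption)

theorem isIdealPred_inf {I J : Submodule F A} (hI : IsIdealPred OA I) (hJ : IsIdealPred OA J) :
    IsIdealPred OA (I ⊓ J) :=
  fun n c v j hv => ⟨hI n c v j hv.1, hJ n c v j hv.2⟩

/-- Multiplications with at least two inputs in `P` vanish if `P` lies in the sum of two ideals
that are both disjoint from the ideal `P`. -/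
theorem not_hasNonzeroMul_of_le_sup {P I B : Submodule F A} (hP : IsIdealPred OA P)
    (hI : IsIdealPred OA I) (hB : IsIdealPred OA B) (hPI : Disjoint P I) (hPB : Disjoint P B)
    (hle : P ≤ I ⊔ B) : ¬ HasNonzeroMul OA P := by
  rintro ⟨n, hn, c, v, hv, hne⟩
  let j : Fin n := ⟨0, by omega⟩
  let k : Fin n := ⟨1, by omega⟩
  have hkj : k ≠ j := by simp [j, k, Fin.ext_iff]
  have vanish : ∀ J : Submodule F A, IsIdealPred OA J → Disjoint P J → ∀ a ∈ J,
      OA.α n c (Function.update v j a) = 0 := fun J hJ hPJ a ha =>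
    Submodule.disjoint_def.1 hPJ _
      (hP n c _ k (by simpa [Function.update_of_ne hkj] using hv k))
      (hJ n c _ j (by simpa using ha))
  obtain ⟨x, hx, b, hb, hxb⟩ := Submodule.mem_sup.1 (hle (hv j))
  apply hne
  rw [← Function.update_eq_self j v, ← hxb, MultilinearMap.map_update_add,
    vanish I hI hPI x hx, vanish B hB hPB b hb, add_zero]

/-- An ideal either contains a given simple summand or lies in an ideal complement of it. -/
theorem le_or_le_of_isSimplePiece {P I B : Submodule F A} (hP : IsSimplePiece OA P)
    (hI : IsIdealPred OA I) (hB : IsIdealPred OA B) (hPB : IsCompl P B) : P ≤ I ∨ I ≤ B := by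
  rcases hP.2.1 (P ⊓ I) inf_le_left (isIdealPred_inf hP.1 hI) with hPI | hPI
  · rcases hP.2.1 (P ⊓ (I ⊔ B)) inf_le_left
      (isIdealPred_inf hP.1 (isIdealPred_sup hI hB)) with h | h
    · right
      have : B ⊔ P ⊓ (I ⊔ B) = I ⊔ B := by
        rw [← sup_inf_assoc_of_le P le_sup_right, sup_comm, hPB.sup_eq_top, top_inf_eq]
      rw [h, sup_bot_eq] at this
      exact le_sup_left.trans this.ge
    · exact absurd hP.2.2 (not_hasNonzeroMul_of_le_sup hP.1 hI hB (disjoint_iff.2 hPI)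
        hPB.disjoint (inf_eq_left.1 h))
  · exact Or.inl (inf_eq_left.1 hPI)

end OperadAlgebraOn

/-- In an internal direct sum, an element lying in all the complements `⨆ k ≠ i, P k` for `i ∉ S`
lies in the subsum over `S`. -/
theorem iSupIndep.iInf_iSup_ne_le {R M ι : Type*} [Ring R] [AddCommGroup M] [Module R M]
    [Finite ι] {P : ι → Submodule R M} (hP : iSupIndep P) (htop : ⨆ i, P i = ⊤) (S : Set ι) :
    ⨅ i ∉ S, ⨆ k ≠ i, P k ≤ ⨆ i ∈ S, P i := by
  classical
  intro x hx
  simp only [Submodule.mem_iInf] at hx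
  obtain ⟨f, hf, rfl⟩ := (Submodule.mem_iSup_iff_exists_finsupp P x).1 (htop ▸ Submodule.mem_top)
  refine Submodule.sum_mem _ fun i hi => ?_
  by_cases hS : i ∈ S
  · exact Submodule.mem_iSup_of_mem i (Submodule.mem_iSup_of_mem hS (hf i))
  · have hrest : ∑ k ∈ f.support.erase i, f k ∈ ⨆ k ≠ i, P k :=
      Submodule.sum_mem _ fun k hk => Submodule.mem_iSup_of_mem k
        (Submodule.mem_iSup_of_mem (Finset.ne_of_mem_erase hk) (hf k))
    have hsum : f i + ∑ k ∈ f.support.erase i, f k ∈ ⨆ k ≠ i, P k := by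
      rw [Finset.add_sum_erase _ _ hi]
      exact hx i hS
    rw [Submodule.disjoint_def.1 (hP i) _ (hf i) ((Submodule.add_mem_iff_left _ hrest).1 hsum)]
    exact Submodule.zero_mem _

/-- the ideals of a semisimple algebra `A = A₁ ⊕ ... ⊕ A_m` are exactly
the subsums `⊕_{i ∈ S} A_i`. -/
theorem ideals_of_semisimple {F : Type} [Field F] {O : LinearOperadData F}
    {A : Type} [AddCommGroup A] [Module F A] [FiniteDimensional F A]
    (OA : OperadAlgebraOn F O A)
    {m : ℕ} (Ai : Fin m → Submodule F A)
    (hindep : iSupIndep Ai) (hsup : (⨆ i, Ai i) = ⊤)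
    (hsimple : ∀ i, IsSimplePiece OA (Ai i)) :
    ∀ I : Submodule F A, IsIdealPred OA I ↔ ∃ S : Set (Fin m), I = ⨆ i ∈ S, Ai i := by
  intro I
  constructor
  · intro hI
    refine ⟨{i | Ai i ≤ I}, le_antisymm ?_ (iSup₂_le fun i hi => hi)⟩
    refine le_trans ?_ (hindep.iInf_iSup_ne_le hsup {i | Ai i ≤ I})
    refine le_iInf₂ fun i hi => ?_
    have hcompl : IsCompl (Ai i) (⨆ k ≠ i, Ai k) := by
      refine ⟨hindep i, codisjoint_iff_le_sup.2 (hsup ▸ iSup_le fun k => ?_)⟩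
      by_cases hk : k = i
      · exact hk ▸ le_sup_left
      · exact le_sup_of_le_right (le_iSup₂_of_le k hk le_rfl)
    exact (OperadAlgebraOn.le_or_le_of_isSimplePiece (hsimple i) hI
      (OperadAlgebraOn.isIdealPred_iSup fun k => OperadAlgebraOn.isIdealPred_iSup fun _ =>
        (hsimple k).1) hcompl).resolve_left hi
  · rintro ⟨S, rfl⟩
    exact OperadAlgebraOn.isIdealPred_iSup fun k => OperadAlgebraOn.isIdealPred_iSup fun _ =>
      (hsimple k).1
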